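/- arXiv:1705.06630 — 2 statements merged into one kernel-verified Lean document; each statement's English description precedes it below -/
import Mathlib

section
/- Let λ ∈ ℝ, let y₀ > 3λ and c ∈ ℝ, and define Y₁ : (3λ, ∞) → ℝ by Y₁(y) = (y − 3λ)·( c + ∫_{y₀}^{y} e^{−(3/2)λ·arctan(s)}·(s² + 1)^{1/4}·(s − 3λ)^{−2} ds ). Then Y₁ is smooth and satisfies on (3λ, ∞) the second-order linear ODE (y² + 1)·Y₁''(y) − (1/2)(y − 3λ)·Y₁'(y) + (1/2)·Y₁(y) = 0. -/
open Real

/-- `Y₁(y) = (y − 3λ)(c + ∫_{y₀}^{y} e^{−(3/2)λ arctan s} (s² + 1)^{1/4} (s − 3λ)⁻² ds)`. -/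
noncomputable def Y₁ (lam y₀ c : ℝ) (y : ℝ) : ℝ :=
  (y - 3 * lam) *
    (c + ∫ s in y₀..y,
      Real.exp (-(3 / 2) * lam * Real.arctan s) * (s ^ 2 + 1) ^ ((1 : ℝ) / 4)
        / (s - 3 * lam) ^ 2)

noncomputable def fInt (lam s : ℝ) : ℝ :=
  Real.exp (-(3 / 2) * lam * Real.arctan s) * (s ^ 2 + 1) ^ ((1 : ℝ) / 4) / (s - 3 * lam) ^ 2

lemma fInt_contDiffOn (lam : ℝ) : ContDiffOn ℝ (⊤ : ℕ∞) (fInt lam) (Set.Ioi (3 * lam)) := by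
  intro s hs
  have hs' : (s - 3 * lam) ^ 2 ≠ 0 := pow_ne_zero 2 (sub_ne_zero.2 (ne_of_gt hs))
  have h1 : s ^ 2 + 1 ≠ 0 := by positivity
  apply ContDiffAt.contDiffWithinAt
  unfold fInt
  refine ContDiffAt.div (ContDiffAt.mul ?_ ?_) ?_ hs'
  · exact (contDiffAt_const.mul Real.contDiff_arctan.contDiffAt).exp
  · exact ContDiffAt.rpow_const_of_ne (by fun_prop) h1
  · fun_prop

lemma fInt_hasDerivAt (lam y : ℝ) (hy : 3 * lam < y) :
    HasDerivAt (fInt lam)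
      (fInt lam y * ((y - 3 * lam) / (2 * (y ^ 2 + 1)) - 2 / (y - 3 * lam))) y := by
  have ht : y - 3 * lam ≠ 0 := sub_ne_zero.2 (ne_of_gt hy)
  have h1 : y ^ 2 + 1 ≠ 0 := by positivity
  have hE := ((Real.hasDerivAt_arctan y).const_mul (-(3 / 2) * lam)).exp
  have hP := (((hasDerivAt_id y).pow 2).add_const 1).rpow_const (p := (1 : ℝ) / 4) (Or.inl (by simpa using h1))
  have hD := ((hasDerivAt_id y).sub_const (3 * lam)).pow 2
  have h := (hE.mul hP).div hD (by simpa using ht)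
  refine h.congr_deriv ?_
  simp only [id, Pi.pow_apply, Pi.mul_apply]
  rw [Real.rpow_sub_one h1]
  have h2 : (1 : ℝ) + y ^ 2 ≠ 0 := by positivity
  unfold fInt
  field_simp
  ring

lemma F_hasDerivAt (lam y₀ c y : ℝ) (hy₀ : 3 * lam < y₀) (hy : 3 * lam < y) :
    HasDerivAt (fun y => c + ∫ s in y₀..y, fInt lam s) (fInt lam y) y := by
  have hc := (fInt_contDiffOn lam).continuousOn
  refine HasDerivAt.const_add c ?_
  refine intervalIntegral.integral_hasDerivAt_right ?_ ?_ ?_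
  · apply ContinuousOn.intervalIntegrable
    exact hc.mono (fun s hs => lt_of_lt_of_le (lt_min hy₀ hy) hs.1)
  · exact hc.stronglyMeasurableAtFilter isOpen_Ioi y hy
  · exact hc.continuousAt (isOpen_Ioi.mem_nhds hy)

/-- The function `Y₁` is smooth on `(3λ, ∞)` and satisfies there the second-order ODE
`(y² + 1) Y₁'' − (1/2)(y − 3λ) Y₁' + (1/2) Y₁ = 0`. -/
theorem stmt_12 (lam y₀ c : ℝ) (hy₀ : 3 * lam < y₀) :
    ContDiffOn ℝ (⊤ : ℕ∞) (Y₁ lam y₀ c) (Set.Ioi (3 * lam)) ∧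
    ∀ y : ℝ, 3 * lam < y →
      (y ^ 2 + 1) * deriv (deriv (Y₁ lam y₀ c)) y
        - (1 / 2) * (y - 3 * lam) * deriv (Y₁ lam y₀ c) y
        + (1 / 2) * Y₁ lam y₀ c y = 0 := by
  have hY : Y₁ lam y₀ c = fun y => (y - 3 * lam) * (c + ∫ s in y₀..y, fInt lam s) := rfl
  have hF := fun y hy => F_hasDerivAt lam y₀ c y hy₀ hy
  have hd1 : ∀ y, 3 * lam < y → HasDerivAt (Y₁ lam y₀ c)
      ((c + ∫ s in y₀..y, fInt lam s) + (y - 3 * lam) * fInt lam y) y := by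
    intro y hy
    rw [hY]
    exact (((hasDerivAt_id y).sub_const (3 * lam)).mul (hF y hy)).congr_deriv (by simp)
  constructor
  · rw [hY]
    refine ContDiffOn.mul (by fun_prop) ?_
    rw [contDiffOn_infty_iff_deriv_of_isOpen isOpen_Ioi]
    refine ⟨fun y hy => (hF y hy).differentiableAt.differentiableWithinAt, ?_⟩
    exact (fInt_contDiffOn lam).congr (fun y hy => (hF y hy).deriv)
  · intro y hy
    have ht : y - 3 * lam ≠ 0 := sub_ne_zero.2 (ne_of_gt hy)
    have h1 : y ^ 2 + 1 ≠ 0 := by positivity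
    have hev : deriv (Y₁ lam y₀ c) =ᶠ[nhds y]
        fun y => (c + ∫ s in y₀..y, fInt lam s) + (y - 3 * lam) * fInt lam y :=
      Filter.eventually_of_mem (isOpen_Ioi.mem_nhds hy) (fun z hz => (hd1 z hz).deriv)
    have hd2 := (hF y hy).add
      (((hasDerivAt_id y).sub_const (3 * lam)).mul (fInt_hasDerivAt lam y hy))
    have hd2' := (hd2.congr_of_eventuallyEq hev).deriv
    rw [hd2', (hd1 y hy).deriv, hY]
    simp only [id]
    field_simp
    ring
end

section
/- Define Y : (0, ∞) → ℝ by Y(y) = ∫₁^{y} e^{3/(2s)}·s^{−3/2} ds, and let D = {(x, y) ∈ ℝ² : y > 0 and Y(y) + x ≠ 0}. For κ ≠ 0 let G_κ be the matrix field of the metric κ·(Y(y)+x)dxdy, i.e. G_κ(x,y) = [[0, κ(Y(y)+x)/2], [κ(Y(y)+x)/2, 0]]. Let κ, κ̃ ∈ ℝ∖{0}, let U ⊆ D be a nonempty connected open set, and let τ : U → D be a smooth map with everywhere invertible differential such that Dτ(p)ᵀ·G_{κ̃}(τ(p))·Dτ(p) = G_κ(p) for all p ∈ U. Then κ̃ =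 κ. -/
open Real Matrix

/-- Partial derivative in direction `i` (0 = x, 1 = y) of a function on `ℝ × ℝ`. -/
noncomputable def pd (i : Fin 2) (f : ℝ × ℝ → ℝ) (p : ℝ × ℝ) : ℝ :=
  fderiv ℝ f p (if i = 0 then (1, 0) else (0, 1))

/-- Jacobian matrix of a map `τ : ℝ × ℝ → ℝ × ℝ`. -/
noncomputable def jac (τ : ℝ × ℝ → ℝ × ℝ) (p : ℝ × ℝ) : Matrix (Fin 2) (Fin 2) ℝ :=
  Matrix.of fun i j => pd j (fun q => if i = 0 then (τ q).1 else (τ q).2) p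

/-- `Y(y) = ∫₁^y e^{3/(2s)} s^{−3/2} ds`. -/
noncomputable def Yfun (y : ℝ) : ℝ :=
  ∫ s in (1 : ℝ)..y, Real.exp (3 / (2 * s)) * s ^ (-(3 : ℝ) / 2)

/-- The domain `D = {(x,y) : y > 0 and Y(y) + x ≠ 0}`. -/
def Dom : Set (ℝ × ℝ) := {p | 0 < p.2 ∧ Yfun p.2 + p.1 ≠ 0}

/-- Matrix of the metric `κ (Y(y) + x) dxdy`. -/
noncomputable def Gk (κ : ℝ) (p : ℝ × ℝ) : Matrix (Fin 2) (Fin 2) ℝ :=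
  !![0, κ * (Yfun p.2 + p.1) / 2; κ * (Yfun p.2 + p.1) / 2, 0]

noncomputable def hfun (s : ℝ) : ℝ := Real.exp (3 / (2 * s)) * s ^ (-(3 : ℝ) / 2)

lemma hfun_pos {s : ℝ} (hs : 0 < s) : 0 < hfun s := by
  unfold hfun; positivity

lemma hfun_deriv {s : ℝ} (hs : 0 < s) :
    HasDerivAt hfun (-(3 / 2) * (1 / s ^ 2 + 1 / s) * hfun s) s := by
  have h1 : HasDerivAt (fun s : ℝ => 3 / (2 * s)) ((0 * (2 * s) - 3 * (2 * 1)) / (2 * s) ^ 2) s :=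
    (hasDerivAt_const s (3 : ℝ)).div ((hasDerivAt_id s).const_mul 2) (by simp; exact hs.ne')
  have h2 := Real.hasDerivAt_rpow_const (x := s) (p := -(3 : ℝ) / 2) (Or.inl hs.ne')
  have h3 := h1.exp.mul h2
  have e : s ^ (-(3 : ℝ) / 2 - 1) = s ^ (-(3 : ℝ) / 2) / s := by
    rw [Real.rpow_sub hs, Real.rpow_one]
  rw [e] at h3
  refine h3.congr_deriv ?_
  unfold hfun
  field_simp
  ring

lemma Y_deriv {y : ℝ} (hy : 0 < y) : HasDerivAt Yfun (hfun y) y := by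
  have hc : ContinuousOn hfun (Set.Ioi 0) := fun s hs =>
    (hfun_deriv hs).continuousAt.continuousWithinAt
  have hsub : Set.uIcc 1 y ⊆ Set.Ioi 0 := by
    intro s hs
    rcases Set.mem_uIcc.1 hs with h | h
    · exact lt_of_lt_of_le one_pos h.1
    · exact lt_of_lt_of_le hy h.1
  have := intervalIntegral.integral_hasDerivAt_right (f := hfun) (a := 1) (b := y)
    ((hc.mono hsub).intervalIntegrable)
    (hc.stronglyMeasurableAtFilter isOpen_Ioi y hy) (hfun_deriv hy).continuousAt
  exact this

lemma deq {S : Set ℝ} (hS : IsOpen S) {F G : ℝ → ℝ} (h : ∀ x ∈ S, F x = G x) {x F' G' : ℝ}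
    (hx : x ∈ S) (hF : HasDerivAt F F' x) (hG : HasDerivAt G G' x) : F' = G' := by
  have : F =ᶠ[nhds x] G := Filter.eventuallyEq_of_mem (hS.mem_nhds hx) h
  exact (hF.congr_of_eventuallyEq this.symm).unique hG

/-- The final algebraic step. -/
lemma alg_final {m b y : ℝ} (hb : 0 < b) (hy : 0 < y)
    (h1 : m * (1 / b ^ 2 + 1 / b) = 1 / y ^ 2 + 1 / y)
    (h2 : m ^ 2 * (2 / b ^ 3 + 1 / b ^ 2) = 2 / y ^ 3 + 1 / y ^ 2) : b = y ∧ m = 1 := by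
  obtain ⟨s, hs, rfl⟩ : ∃ s, 0 < s ∧ b = s⁻¹ := ⟨b⁻¹, by positivity, by simp⟩
  obtain ⟨v, hv, rfl⟩ : ∃ s, 0 < s ∧ y = s⁻¹ := ⟨y⁻¹, by positivity, by simp⟩
  simp only [inv_pow, div_inv_eq_mul, one_mul] at h1 h2
  have k : (2 * s ^ 3 + s ^ 2) * (v ^ 2 + v) ^ 2 = (2 * v ^ 3 + v ^ 2) * (s ^ 2 + s) ^ 2 := by
    rw [← h1, ← h2]; ring
  have k2 : s ^ 2 * v ^ 2 * ((v - s) * (v + s + 2 * s * v)) = 0 := by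
    linear_combination k
  have : s = v := by
    have p1 : s ^ 2 * v ^ 2 ≠ 0 := by positivity
    have p2 : v + s + 2 * s * v ≠ 0 := by positivity
    have := (mul_eq_zero.1 k2).resolve_left p1
    have := (mul_eq_zero.1 this).resolve_right p2
    linarith
  subst this
  refine ⟨rfl, ?_⟩
  have p : s ^ 2 + s ≠ 0 := by positivity
  exact mul_right_cancel₀ p (by rw [h1, one_mul])

lemma case_one {κ κt : ℝ} (hκ : κ ≠ 0) {I J : Set ℝ} (hI : IsOpen I) (hJ : IsOpen J)
    {x0 y0 : ℝ} (hx0 : x0 ∈ I) (hy0 : y0 ∈ J) {a a1 a2 a3 b b1 : ℝ → ℝ}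
    (ha : ∀ x ∈ I, HasDerivAt a (a1 x) x) (ha1 : ∀ x ∈ I, HasDerivAt a1 (a2 x) x)
    (ha2 : ∀ x ∈ I, HasDerivAt a2 (a3 x) x)
    (hb : ∀ y ∈ J, HasDerivAt b (b1 y) y)
    (hJp : ∀ y ∈ J, 0 < y) (hbp : ∀ y ∈ J, 0 < b y)
    (hne : ∀ x ∈ I, ∀ y ∈ J, Yfun y + x ≠ 0)
    (E : ∀ x ∈ I, ∀ y ∈ J, κt * (Yfun (b y) + a x) * (a1 x * b1 y) = κ * (Yfun y + x)) :
    κt = κ := by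
  have N : ∀ x ∈ I, ∀ y ∈ J, κt ≠ 0 ∧ a1 x ≠ 0 ∧ b1 y ≠ 0 := by
    intro x hx y hy
    have h := mul_ne_zero hκ (hne x hx y hy)
    rw [← E x hx y hy] at h
    refine ⟨?_, ?_, ?_⟩ <;> intro h0 <;> apply h <;> rw [h0] <;> ring
  have E1 : ∀ x ∈ I, ∀ y ∈ J,
      κt * (a1 x * (a1 x * b1 y) + (Yfun (b y) + a x) * (a2 x * b1 y)) = κ := by
    intro x hx y hy
    have := deq hI (fun x hx => E x hx y hy) hx
      ((((ha x hx).const_add (Yfun (b y))).const_mul κt).mul ((ha1 x hx).mul_const (b1 y)))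
      (((hasDerivAt_id x).const_add (Yfun y)).const_mul κ)
    linear_combination this
  have E2 : ∀ x ∈ I, ∀ y ∈ J, 3 * a1 x * a2 x + (Yfun (b y) + a x) * a3 x = 0 := by
    intro x hx y hy
    have := deq hI (fun x hx => E1 x hx y hy) hx
      ((((ha1 x hx).mul ((ha1 x hx).mul_const (b1 y))).add
        (((ha x hx).const_add (Yfun (b y))).mul ((ha2 x hx).mul_const (b1 y)))).const_mul κt)
      (hasDerivAt_const x κ)
    obtain ⟨n1, n2, n3⟩ := N x hx y hy
    apply mul_left_cancel₀ (mul_ne_zero n1 n3)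
    linear_combination this
  have hYb : ∀ y ∈ J, HasDerivAt (fun y => Yfun (b y)) (hfun (b y) * b1 y) y := fun y hy =>
    (Y_deriv (hbp y hy)).comp y (hb y hy)
  have A2 : ∀ x ∈ I, a2 x = 0 := by
    intro x hx
    obtain ⟨n1, n2, n3⟩ := N x hx y0 hy0
    have := deq hJ (fun y hy => E2 x hx y hy) hy0
      ((((hYb y0 hy0).add_const (a x)).mul_const (a3 x)).const_add (3 * a1 x * a2 x))
      (hasDerivAt_const y0 0)
    have h3 : a3 x = 0 := by
      refine (mul_eq_zero.1 this).resolve_left (mul_ne_zero (hfun_pos (hbp y0 hy0)).ne' n3)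
    have := E2 x hx y0 hy0
    rw [h3] at this
    apply mul_left_cancel₀ n2
    linear_combination this / 3
  obtain ⟨n1, nA, n3⟩ := N x0 hx0 y0 hy0
  have B1 : ∀ y ∈ J, b1 y = b1 y0 := by
    intro y hy
    have e1 := E1 x0 hx0 y hy
    have e2 := E1 x0 hx0 y0 hy0
    rw [A2 x0 hx0] at e1 e2
    apply mul_left_cancel₀ (mul_ne_zero n1 (mul_ne_zero nA nA))
    linear_combination e1 - e2
  have hc := E1 x0 hx0 y0 hy0
  rw [A2 x0 hx0] at hc
  set m := b1 y0 with hm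
  set A := a1 x0 with hA
  have F0 : ∀ y ∈ J, m * hfun (b y) = A * hfun y := by
    intro y hy
    have := deq hJ (F := fun y => κt * (Yfun (b y) + a x0) * (A * m))
      (fun y hy => by rw [← E x0 hx0 y hy, B1 y hy]) hy
      ((((hYb y hy).add_const (a x0)).const_mul κt).mul_const (A * m))
      (((Y_deriv (hJp y hy)).add_const x0).const_mul κ)
    rw [B1 y hy] at this
    apply mul_left_cancel₀ (mul_ne_zero n1 (mul_ne_zero nA n3))
    linear_combination this - hc * hfun y
  have F1 : ∀ y ∈ J, m * (1 / b y ^ 2 + 1 / b y) = 1 / y ^ 2 + 1 / y := by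
    intro y hy
    have := deq hJ F0 hy (((hfun_deriv (hbp y hy)).comp y (hb y hy)).const_mul m)
      ((hfun_deriv (hJp y hy)).const_mul A)
    rw [B1 y hy] at this
    have n := (hfun_pos (hJp y hy)).ne'
    apply mul_left_cancel₀ (mul_ne_zero nA n)
    linear_combination (-2 / 3) * this - m * (1 / b y ^ 2 + 1 / b y) * F0 y hy
  have hq : ∀ z : ℝ, 0 < z → HasDerivAt (fun z : ℝ => 1 / z ^ 2 + 1 / z)
      (-(2 / z ^ 3 + 1 / z ^ 2)) z := by
    intro z hz
    have h1 := ((hasDerivAt_const z (1 : ℝ)).div (hasDerivAt_pow 2 z) (by positivity)).add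
      ((hasDerivAt_const z (1 : ℝ)).div (hasDerivAt_id z) hz.ne')
    refine h1.congr_deriv ?_
    simp only [id]
    field_simp
    ring
  have F2 : m ^ 2 * (2 / b y0 ^ 3 + 1 / b y0 ^ 2) = 2 / y0 ^ 3 + 1 / y0 ^ 2 := by
    have := deq hJ F1 hy0 (((hq _ (hbp y0 hy0)).comp y0 (hb y0 hy0)).const_mul m)
      (hq _ (hJp y0 hy0))
    rw [← hm] at this
    linear_combination -this
  obtain ⟨r1, r2⟩ := alg_final (hbp y0 hy0) (hJp y0 hy0) (F1 y0 hy0) F2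
  have := F0 y0 hy0
  rw [r1, r2] at this
  have hA1 : (1 : ℝ) = A := mul_right_cancel₀ (hfun_pos (hJp y0 hy0)).ne' this
  rw [r2, ← hA1] at hc
  linear_combination hc

lemma case_two {κ κt : ℝ} (hκ : κ ≠ 0) {I J : Set ℝ} (hI : IsOpen I) (hJ : IsOpen J)
    {x0 y0 : ℝ} (hx0 : x0 ∈ I) (hy0 : y0 ∈ J) {a a1 b b1 b2 b3 : ℝ → ℝ}
    (ha : ∀ y ∈ J, HasDerivAt a (a1 y) y)
    (hb : ∀ x ∈ I, HasDerivAt b (b1 x) x)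
    (hb1 : ∀ x ∈ I, HasDerivAt b1 (b2 x) x)
    (hb2 : ∀ x ∈ I, HasDerivAt b2 (b3 x) x)
    (hbp : ∀ x ∈ I, 0 < b x)
    (hne : ∀ x ∈ I, ∀ y ∈ J, Yfun y + x ≠ 0)
    (E : ∀ x ∈ I, ∀ y ∈ J, κt * (Yfun (b x) + a y) * (a1 y * b1 x) = κ * (Yfun y + x)) :
    False := by
  have N : ∀ x ∈ I, ∀ y ∈ J, κt ≠ 0 ∧ a1 y ≠ 0 ∧ b1 x ≠ 0 := by
    intro x hx y hy
    have h := mul_ne_zero hκ (hne x hx y hy)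
    rw [← E x hx y hy] at h
    refine ⟨?_, ?_, ?_⟩ <;> intro h0 <;> apply h <;> rw [h0] <;> ring
  have hYb : ∀ x ∈ I, HasDerivAt (fun x => Yfun (b x)) (hfun (b x) * b1 x) x := fun x hx =>
    (Y_deriv (hbp x hx)).comp x (hb x hx)
  have hhb : ∀ x ∈ I, HasDerivAt (fun x => hfun (b x)) 
      (-(3 / 2) * (1 / b x ^ 2 + 1 / b x) * hfun (b x) * b1 x) x := fun x hx =>
    (hfun_deriv (hbp x hx)).comp x (hb x hx)
  have E1 : ∀ x ∈ I, ∀ y ∈ J,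
      κt * a1 y * ((hfun (b x) * b1 x) * b1 x + (Yfun (b x) + a y) * b2 x) = κ := by
    intro x hx y hy
    have := deq hI (fun x hx => E x hx y hy) hx
      ((((hYb x hx).add_const (a y)).const_mul κt).mul ((hb1 x hx).const_mul (a1 y)))
      (((hasDerivAt_id x).const_add (Yfun y)).const_mul κ)
    linear_combination this
  have E2 : ∀ x ∈ I, ∀ y ∈ J,
      hfun (b x) * b1 x * (-(3 / 2) * (1 / b x ^ 2 + 1 / b x) * b1 x ^ 2 + 3 * b2 x)
        + (Yfun (b x) + a y) * b3 x = 0 := by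
    intro x hx y hy
    have := deq hI (fun x hx => E1 x hx y hy) hx
      (((((hhb x hx).mul (hb1 x hx)).mul (hb1 x hx)).add
        (((hYb x hx).add_const (a y)).mul (hb2 x hx))).const_mul (κt * a1 y))
      (hasDerivAt_const x κ)
    obtain ⟨n1, n2, n3⟩ := N x hx y hy
    apply mul_left_cancel₀ (mul_ne_zero n1 n2)
    simp only [Pi.mul_apply] at this
    linear_combination this
  have B3 : ∀ x ∈ I, b3 x = 0 := by
    intro x hx
    obtain ⟨n1, n2, n3⟩ := N x hx y0 hy0
    have := deq hJ (fun y hy => E2 x hx y hy) hy0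
      ((((ha y0 hy0).const_add (Yfun (b x))).mul_const (b3 x)).const_add _)
      (hasDerivAt_const y0 0)
    exact (mul_eq_zero.1 this).resolve_left n2
  have B2 : ∀ x ∈ I, 2 * b2 x * b x ^ 2 = (1 + b x) * b1 x ^ 2 := by
    intro x hx
    obtain ⟨n1, n2, n3⟩ := N x hx y0 hy0
    have h := E2 x hx y0 hy0
    rw [B3 x hx, mul_zero, add_zero] at h
    have h := (mul_eq_zero.1 h).resolve_left (mul_ne_zero (hfun_pos (hbp x hx)).ne' n3)
    have hp := hbp x hx
    field_simp at h
    linear_combination h / 3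
  obtain ⟨n1, n2, n3⟩ := N x0 hx0 y0 hy0
  have e := B2 x0 hx0
  have d := deq hI B2 hx0 (((hb2 x0 hx0).const_mul 2).mul ((hb x0 hx0).pow 2))
    (((hb x0 hx0).const_add 1).mul ((hb1 x0 hx0).pow 2))
  rw [B3 x0 hx0] at d
  simp only [Pi.pow_apply, Nat.cast_ofNat, Nat.add_one_sub_one, pow_one] at d
  have hp := hbp x0 hx0
  have : b1 x0 ^ 3 = 0 := by
    generalize b x0 = B at *
    generalize b1 x0 = P at *
    generalize b2 x0 = Q at *
    -- d : 4 Q B P = P * P^2 + (1+B) * (2 P Q)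
    have d' : 2 * Q * B = P ^ 2 + 2 * Q := by
      apply mul_left_cancel₀ n3
      linear_combination d
    have hQ : Q = 0 := by linear_combination (1 / 2) * e + (-(1 + B) / 2) * d'
    have hP : P ^ 2 = 0 := by rw [hQ] at d'; linear_combination -d'
    rw [pow_succ, hP, zero_mul]
  exact n3 (by simpa using this)

lemma contDiff_derivs {S : Set ℝ} (hS : IsOpen S) {f : ℝ → ℝ}
    (hf : ContDiffOn ℝ (⊤ : ℕ∞) f S) :
    (∀ x ∈ S, HasDerivAt f (deriv f x) x) ∧ ContDiffOn ℝ (⊤ : ℕ∞) (deriv f) S := by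
  refine ⟨fun x hx => ?_, hf.deriv_of_isOpen hS (by simp)⟩
  exact ((hf.contDiffAt (hS.mem_nhds hx)).differentiableAt (by simp)).hasDerivAt

lemma sec_x {U : Set (ℝ × ℝ)} (hU : IsOpen U) {f : ℝ × ℝ → ℝ}
    (hf : ContDiffOn ℝ (⊤ : ℕ∞) f U) {x y : ℝ} (h : (x, y) ∈ U) :
    HasDerivAt (fun x => f (x, y)) (pd 0 f (x, y)) x := by
  have h1 := ((hf.contDiffAt (hU.mem_nhds h)).differentiableAt (by simp)).hasFDerivAt
  have h2 : HasDerivAt (fun x : ℝ => (x, y)) ((1 : ℝ), (0 : ℝ)) x :=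
    (hasDerivAt_id x).prodMk (hasDerivAt_const x y)
  simpa [pd, Function.comp_def] using h1.comp_hasDerivAt x h2

lemma sec_y {U : Set (ℝ × ℝ)} (hU : IsOpen U) {f : ℝ × ℝ → ℝ}
    (hf : ContDiffOn ℝ (⊤ : ℕ∞) f U) {x y : ℝ} (h : (x, y) ∈ U) :
    HasDerivAt (fun y => f (x, y)) (pd 1 f (x, y)) y := by
  have h1 := ((hf.contDiffAt (hU.mem_nhds h)).differentiableAt (by simp)).hasFDerivAt
  have h2 : HasDerivAt (fun y : ℝ => (x, y)) ((0 : ℝ), (1 : ℝ)) y :=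
    (hasDerivAt_const y x).prodMk (hasDerivAt_id y)
  simpa [pd, Function.comp_def] using h1.comp_hasDerivAt y h2

lemma pd_cont {U : Set (ℝ × ℝ)} (hU : IsOpen U) {f : ℝ × ℝ → ℝ}
    (hf : ContDiffOn ℝ (⊤ : ℕ∞) f U) (i : Fin 2) : ContinuousOn (pd i f) U := by
  have := hf.continuousOn_fderiv_of_isOpen hU (by simp)
  exact this.clm_apply continuousOn_const

lemma const_of {S : Set ℝ} (hS : IsOpen S) (hS' : IsPreconnected S) {f f' : ℝ → ℝ}
    (h : ∀ x ∈ S, HasDerivAt f (f' x) x) (h0 : ∀ x ∈ S, f' x = 0) {x y : ℝ} (hx : x ∈ S)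
    (hy : y ∈ S) : f x = f y :=
  hS.is_const_of_deriv_eq_zero hS'
    (fun x hx => (h x hx).differentiableAt.differentiableWithinAt)
    (fun x hx => by rw [(h x hx).deriv, h0 x hx]; rfl) hx hy

/-- Around a point where a continuous function does not vanish there is a box. -/
lemma exists_box {U : Set (ℝ × ℝ)} (hU : IsOpen U) {φ : ℝ × ℝ → ℝ} (hφ : ContinuousOn φ U)
    {p : ℝ × ℝ} (hp : p ∈ U) (h : φ p ≠ 0) :
    ∃ r > 0, ∀ x ∈ Metric.ball p.1 r, ∀ y ∈ Metric.ball p.2 r, (x, y) ∈ U ∧ φ (x, y) ≠ 0 := by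
  have h1 : ∀ᶠ q in nhds p, q ∈ U ∧ φ q ≠ 0 :=
    (hU.eventually_mem hp).and ((hφ.continuousAt (hU.mem_nhds hp)).eventually_ne h)
  obtain ⟨r, hr, hb⟩ := Metric.eventually_nhds_iff_ball.1 h1
  refine ⟨r, hr, fun x hx y hy => hb _ ?_⟩
  rw [← ball_prod_same]
  exact ⟨hx, hy⟩

lemma main_aux (κ κt : ℝ) (hκ : κ ≠ 0)
    (U : Set (ℝ × ℝ)) (hU : IsOpen U) (hUn : U.Nonempty) (hUD : U ⊆ Dom)
    (f g : ℝ × ℝ → ℝ) (hf : ContDiffOn ℝ (⊤ : ℕ∞) f U) (hg : ContDiffOn ℝ (⊤ : ℕ∞) g U)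
    (hpos : ∀ p ∈ U, 0 < g p)
    (h1 : ∀ p ∈ U, pd 0 f p * pd 0 g p = 0)
    (h2 : ∀ p ∈ U, pd 1 f p * pd 1 g p = 0)
    (h3 : ∀ p ∈ U, κt * (Yfun (g p) + f p) * (pd 0 f p * pd 1 g p + pd 1 f p * pd 0 g p)
      = κ * (Yfun p.2 + p.1)) : κt = κ := by
  obtain ⟨p, hp⟩ := hUn
  have hs : pd 0 f p * pd 1 g p + pd 1 f p * pd 0 g p ≠ 0 := by
    intro h
    have := h3 p hp
    rw [h, mul_zero] at this
    exact mul_ne_zero hκ (hUD hp).2 this.symm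
  have secx : ∀ F : ℝ × ℝ → ℝ, ContDiffOn ℝ (⊤ : ℕ∞) F U → ∀ (S : Set ℝ) (y : ℝ),
      (∀ x ∈ S, (x, y) ∈ U) → ContDiffOn ℝ (⊤ : ℕ∞) (fun x => F (x, y)) S := by
    intro F hF S y hS
    exact hF.comp (by fun_prop) hS
  by_cases hc : pd 0 f p * pd 1 g p = 0
  · have hc' : pd 1 f p * pd 0 g p ≠ 0 := by rwa [hc, zero_add] at hs
    obtain ⟨r, hr, hb⟩ := exists_box hU ((pd_cont hU hf 1).mul (pd_cont hU hg 0)) hp hc'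
    have hpx := Metric.mem_ball_self (x := p.1) hr
    have hpy := Metric.mem_ball_self (x := p.2) hr
    have z : ∀ x ∈ Metric.ball p.1 r, ∀ y ∈ Metric.ball p.2 r,
        pd 0 f (x, y) = 0 ∧ pd 1 g (x, y) = 0 := by
      intro x hx y hy
      obtain ⟨hm, hn⟩ := hb x hx y hy
      have hn1 := left_ne_zero_of_mul hn
      have hn2 := right_ne_zero_of_mul hn
      exact ⟨(mul_eq_zero.1 (h1 _ hm)).resolve_right hn2,
        (mul_eq_zero.1 (h2 _ hm)).resolve_left hn1⟩
    have fc : ∀ x ∈ Metric.ball p.1 r, ∀ y ∈ Metric.ball p.2 r, f (x, y) = f (p.1, y) := by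
      intro x hx y hy
      exact const_of Metric.isOpen_ball (convex_ball _ _).isPreconnected
        (f := fun x => f (x, y)) (fun x hx => sec_x hU hf (hb x hx y hy).1)
        (fun x hx => (z x hx y hy).1) hx hpx
    have gc : ∀ x ∈ Metric.ball p.1 r, ∀ y ∈ Metric.ball p.2 r, g (x, y) = g (x, p.2) := by
      intro x hx y hy
      exact const_of Metric.isOpen_ball (convex_ball _ _).isPreconnected
        (f := fun y => g (x, y)) (fun y hy => sec_y hU hg (hb x hx y hy).1)
        (fun y hy => (z x hx y hy).2) hy hpy
    obtain ⟨B1, B1'⟩ := contDiff_derivs Metric.isOpen_ball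
      (secx g hg (Metric.ball p.1 r) p.2 (fun x hx => (hb x hx p.2 hpy).1))
    obtain ⟨B2, B2'⟩ := contDiff_derivs Metric.isOpen_ball B1'
    obtain ⟨B3, -⟩ := contDiff_derivs Metric.isOpen_ball B2'
    exfalso
    refine case_two (κt := κt) hκ Metric.isOpen_ball Metric.isOpen_ball hpx hpy
      (a := fun y => f (p.1, y)) (a1 := fun y => pd 1 f (p.1, y))
      (fun y hy => sec_y hU hf (hb _ hpx y hy).1) B1 B2 B3
      (fun x hx => hpos _ (hb x hx _ hpy).1)
      (fun x hx y hy => (hUD (hb x hx y hy).1).2) ?_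
    intro x hx y hy
    have e := h3 _ (hb x hx y hy).1
    have d1 : pd 0 g (x, y) = deriv (fun x => g (x, p.2)) x :=
      deq Metric.isOpen_ball (fun x hx => gc x hx y hy) hx
        (sec_x hU hg (hb x hx y hy).1) (B1 x hx)
    have d2 : pd 1 f (x, y) = pd 1 f (p.1, y) :=
      deq Metric.isOpen_ball (fun y hy => fc x hx y hy) hy
        (sec_y hU hf (hb x hx y hy).1) (sec_y hU hf (hb _ hpx y hy).1)
    rw [(z x hx y hy).1, d1, d2, gc x hx y hy, fc x hx y hy, zero_mul, zero_add] at e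
    exact e
  · obtain ⟨r, hr, hb⟩ := exists_box hU ((pd_cont hU hf 0).mul (pd_cont hU hg 1)) hp hc
    have hpx := Metric.mem_ball_self (x := p.1) hr
    have hpy := Metric.mem_ball_self (x := p.2) hr
    have z : ∀ x ∈ Metric.ball p.1 r, ∀ y ∈ Metric.ball p.2 r,
        pd 1 f (x, y) = 0 ∧ pd 0 g (x, y) = 0 := by
      intro x hx y hy
      obtain ⟨hm, hn⟩ := hb x hx y hy
      have hn1 := left_ne_zero_of_mul hn
      have hn2 := right_ne_zero_of_mul hn
      exact ⟨(mul_eq_zero.1 (h2 _ hm)).resolve_right hn2,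
        (mul_eq_zero.1 (h1 _ hm)).resolve_left hn1⟩
    have fc : ∀ x ∈ Metric.ball p.1 r, ∀ y ∈ Metric.ball p.2 r, f (x, y) = f (x, p.2) := by
      intro x hx y hy
      exact const_of Metric.isOpen_ball (convex_ball _ _).isPreconnected
        (f := fun y => f (x, y)) (fun y hy => sec_y hU hf (hb x hx y hy).1)
        (fun y hy => (z x hx y hy).1) hy hpy
    have gc : ∀ x ∈ Metric.ball p.1 r, ∀ y ∈ Metric.ball p.2 r, g (x, y) = g (p.1, y) := by
      intro x hx y hy
      exact const_of Metric.isOpen_ball (convex_ball _ _).isPreconnected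
        (f := fun x => g (x, y)) (fun x hx => sec_x hU hg (hb x hx y hy).1)
        (fun x hx => (z x hx y hy).2) hx hpx
    obtain ⟨A1, A1'⟩ := contDiff_derivs Metric.isOpen_ball
      (secx f hf (Metric.ball p.1 r) p.2 (fun x hx => (hb x hx p.2 hpy).1))
    obtain ⟨A2, A2'⟩ := contDiff_derivs Metric.isOpen_ball A1'
    obtain ⟨A3, -⟩ := contDiff_derivs Metric.isOpen_ball A2'
    refine case_one (κt := κt) hκ Metric.isOpen_ball Metric.isOpen_ball hpx hpy A1 A2 A3
      (b := fun y => g (p.1, y)) (b1 := fun y => pd 1 g (p.1, y))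
      (fun y hy => sec_y hU hg (hb _ hpx y hy).1)
      (fun y hy => (hUD (hb _ hpx y hy).1).1)
      (fun y hy => hpos _ (hb _ hpx y hy).1)
      (fun x hx y hy => (hUD (hb x hx y hy).1).2) ?_
    intro x hx y hy
    have e := h3 _ (hb x hx y hy).1
    have d1 : pd 0 f (x, y) = deriv (fun x => f (x, p.2)) x :=
      deq Metric.isOpen_ball (fun x hx => fc x hx y hy) hx
        (sec_x hU hf (hb x hx y hy).1) (A1 x hx)
    have d2 : pd 1 g (x, y) = pd 1 g (p.1, y) :=
      deq Metric.isOpen_ball (fun y hy => gc x hx y hy) hy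
        (sec_y hU hg (hb x hx y hy).1) (sec_y hU hg (hb _ hpx y hy).1)
    rw [(z x hx y hy).1, d1, d2, gc x hx y hy, fc x hx y hy, zero_mul, add_zero] at e
    exact e

/-- Normal forms `κ (Y(y)+x) dxdy` of the Jordan-block case C(II) with different values
of `κ` are non-isometric: a smooth map with everywhere invertible differential pulling
back `G_{κ̃}` to `G_κ` forces `κ̃ = κ`. -/
theorem stmt_13 (κ κt : ℝ) (hκ : κ ≠ 0) (hκt : κt ≠ 0)
    (U : Set (ℝ × ℝ)) (hUopen : IsOpen U) (hUconn : IsConnected U) (hUD : U ⊆ Dom)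
    (τ : ℝ × ℝ → ℝ × ℝ) (hτmaps : Set.MapsTo τ U Dom)
    (hτsmooth : ContDiffOn ℝ (⊤ : ℕ∞) τ U)
    (hτdet : ∀ p ∈ U, (jac τ p).det ≠ 0)
    (hpull : ∀ p ∈ U, (jac τ p)ᵀ * Gk κt (τ p) * jac τ p = Gk κ p) :
    κt = κ := by
  have hE : ∀ p ∈ U,
      pd 0 (fun q => (τ q).1) p * pd 0 (fun q => (τ q).2) p = 0 ∧
      pd 1 (fun q => (τ q).1) p * pd 1 (fun q => (τ q).2) p = 0 ∧
      κt * (Yfun (τ p).2 + (τ p).1) * (pd 0 (fun q => (τ q).1) p * pd 1 (fun q => (τ q).2) p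
        + pd 1 (fun q => (τ q).1) p * pd 0 (fun q => (τ q).2) p) = κ * (Yfun p.2 + p.1) := by
    intro p hp
    have h := hpull p hp
    have hn : κt * (Yfun (τ p).2 + (τ p).1) ≠ 0 := mul_ne_zero hκt (hτmaps hp).2
    have h00 := congrFun (congrFun h 0) 0
    have h01 := congrFun (congrFun h 0) 1
    have h11 := congrFun (congrFun h 1) 1
    simp [jac, Gk, Matrix.mul_apply, Fin.sum_univ_two] at h00 h01 h11
    refine ⟨?_, ?_, ?_⟩
    · apply mul_left_cancel₀ hn
      linear_combination h00
    · apply mul_left_cancel₀ hn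
      linear_combination h11
    · linear_combination 2 * h01
  exact main_aux κ κt hκ U hUopen hUconn.nonempty hUD (fun q => (τ q).1) (fun q => (τ q).2)
    hτsmooth.fst hτsmooth.snd (fun p hp => (hτmaps hp).1)
    (fun p hp => (hE p hp).1) (fun p hp => (hE p hp).2.1) (fun p hp => (hE p hp).2.2)
end
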